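/- Let (W,S) be a Coxeter system of finite rank and let C = W_I w W_J be a minimal presentation of a parabolic double coset C. Then M_L(C) = I ∪ { s ∈ (w J w⁻¹) ∩ S : s is not adjacent to any element of I }, and symmetrically M_R(C) = J ∪ { s ∈ (w⁻¹ I w) ∩ S : s is not adjacent to any element of J }. -/

import Mathlib

open CoxeterSystem

variable {B : Type*} {W : Type*} [Group W]

/-- The standard parabolic subgroup `W_I` of a Coxeter system, generated by the
simple reflections indexed by `I`. -/
def CoxeterSystem.parabolic {M : CoxeterMatrix B} (cs : CoxeterSystem M W) (I : Set B) :
    Subgroup W :=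
  Subgroup.closure (cs.simple '' I)

/-- The parabolic double coset `W_I w W_J`. -/
def CoxeterSystem.doubleCoset {M : CoxeterMatrix B} (cs : CoxeterSystem M W) (I : Set B)
    (w : W) (J : Set B) : Set W :=
  {x | ∃ u ∈ cs.parabolic I, ∃ v ∈ cs.parabolic J, x = u * w * v}

/-- Two simple reflections are adjacent in the Coxeter graph if they are distinct and
do not commute. -/
def CoxeterSystem.adjacent {M : CoxeterMatrix B} (cs : CoxeterSystem M W) (s t : B) : Prop :=
  s ≠ t ∧ cs.simple s * cs.simple t ≠ cs.simple t * cs.simple s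

/-- The connected component of `i` in the subgraph of the Coxeter graph induced by `I`. -/
def CoxeterSystem.component {M : CoxeterMatrix B} (cs : CoxeterSystem M W) (I : Set B)
    (i : B) : Set B :=
  {j | Relation.ReflTransGen (fun a b => a ∈ I ∧ b ∈ I ∧ cs.adjacent a b) i j}

/-- A presentation `C = W_I w W_J` is minimal if `I` consists of left ascents of `w`, `J`
consists of right ascents of `w`, no connected component of `I` is contained in
`(w J w⁻¹) ∩ S`, and no connected component of `J` is contained in `(w⁻¹ I w) ∩ S`. -/
def CoxeterSystem.IsMinimalPresentation {M : CoxeterMatrix B} (cs : CoxeterSystem M W)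
    (I : Set B) (w : W) (J : Set B) : Prop :=
  (∀ s ∈ I, cs.length w < cs.length (cs.simple s * w)) ∧
  (∀ s ∈ J, cs.length w < cs.length (w * cs.simple s)) ∧
  (∀ i ∈ I, ¬ (cs.component I i ⊆ {s : B | ∃ t ∈ J, cs.simple s = w * cs.simple t * w⁻¹})) ∧
  (∀ j ∈ J, ¬ (cs.component J j ⊆ {s : B | ∃ t ∈ I, cs.simple s = w⁻¹ * cs.simple t * w}))

namespace CoxeterSystem

open List

variable {M : CoxeterMatrix B} (cs : CoxeterSystem M W)

section Exchange

theorem end_mul_apply {α : Type*} (f g : Function.End α) (a : α) : (f * g) a = f (g a) := rfl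

open Classical in
/-- The action of a simple reflection on pairs of a group element and a parity: the element is
conjugated, and the parity changes when the element is the simple reflection itself. -/
noncomputable def simpleParity (i : B) : Function.End (W × ZMod 2) :=
  fun p => (cs.simple i * p.1 * cs.simple i, p.2 + if p.1 = cs.simple i then 1 else 0)

open Classical in
theorem simpleParity_mul_pow (i j : B) (n : ℕ) (t : W) (ε : ZMod 2) :
    ((cs.simpleParity i * cs.simpleParity j) ^ n) (t, ε) =
      ((cs.simple i * cs.simple j) ^ n * t * ((cs.simple i * cs.simple j) ^ n)⁻¹,
        ε + ∑ k ∈ Finset.range (2 * n),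
          if t = ((cs.simple i * cs.simple j) ^ k)⁻¹ * cs.simple j then 1 else 0) := by
  induction n with
  | zero => simp [Function.End.one_def]
  | succ n ih =>
    set r := cs.simple i * cs.simple j with hr
    have hinv : r⁻¹ = cs.simple j * cs.simple i := by simp [hr]
    have hconj : ∀ k : ℕ, cs.simple j * r ^ k = (r ^ k)⁻¹ * cs.simple j := by
      intro k
      have h1 : cs.simple j * r * (cs.simple j)⁻¹ = r⁻¹ := by
        rw [hinv, hr]; simp [mul_assoc]
      have h2 := congrArg (· ^ k) h1
      simp only [conj_pow] at h2
      rw [← inv_pow, ← h2]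
      simp [mul_assoc]
    have e1 : (r ^ n * t * (r ^ n)⁻¹ = cs.simple j) ↔ t = (r ^ (2 * n))⁻¹ * cs.simple j := by
      rw [mul_inv_eq_iff_eq_mul, ← eq_inv_mul_iff_mul_eq, hconj, two_mul, pow_add, mul_inv_rev,
        mul_assoc]
    have e2 : (cs.simple j * (r ^ n * t * (r ^ n)⁻¹) * cs.simple j = cs.simple i) ↔
        t = (r ^ (2 * n + 1))⁻¹ * cs.simple j := by
      have h3 : (r ^ (2 * n + 1))⁻¹ * cs.simple j =
          (r ^ n)⁻¹ * (cs.simple j * cs.simple i * cs.simple j) * r ^ n := by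
        rw [mul_assoc _ _ (r ^ n), mul_assoc (cs.simple j * cs.simple i), hconj, ← hinv,
          show 2 * n + 1 = n + 1 + n by ring, pow_add, pow_succ]
        group
      rw [h3]
      constructor
      · intro h
        rw [← h]
        simp [mul_assoc]
      · intro h
        rw [h]
        simp [mul_assoc]
    rw [pow_succ', end_mul_apply, ih, end_mul_apply]
    simp only [simpleParity, e1, e2]
    rw [show 2 * (n + 1) = 2 * n + 1 + 1 by ring, Finset.sum_range_succ, Finset.sum_range_succ]
    refine Prod.ext ?_ ?_
    · simp only [pow_succ', mul_inv_rev, hr]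
      simp [mul_assoc]
    · simp only [add_assoc]

theorem isLiftable_simpleParity : M.IsLiftable cs.simpleParity := by
  classical
  intro i j
  funext ⟨t, ε⟩
  rw [simpleParity_mul_pow, two_mul, Finset.sum_range_add]
  simp only [pow_add, cs.simple_mul_simple_pow, one_mul]
  rw [CharTwo.add_self_eq_zero]
  simp [Function.End.one_def]

open Classical in
theorem lift_simpleParity_wordProd (ω : List B) (t : W) (ε : ZMod 2) :
    cs.lift ⟨cs.simpleParity, cs.isLiftable_simpleParity⟩ (cs.wordProd ω) (t, ε) =
      (cs.wordProd ω * t * (cs.wordProd ω)⁻¹, ε + (cs.rightInvSeq ω).count t) := by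
  induction ω with
  | nil => simp [Function.End.one_def]
  | cons i ω ih =>
    rw [wordProd_cons, map_mul, end_mul_apply, ih, lift_apply_simple]
    refine Prod.ext ?_ ?_
    · simp [simpleParity, mul_assoc]
    · simp only [simpleParity, rightInvSeq, List.count_cons, beq_iff_eq]
      have : (cs.wordProd ω * t * (cs.wordProd ω)⁻¹ = cs.simple i) ↔
          ((cs.wordProd ω)⁻¹ * cs.simple i * cs.wordProd ω = t) := by
        rw [mul_inv_eq_iff_eq_mul, ← eq_inv_mul_iff_mul_eq, eq_comm, mul_assoc]
      simp only [this]
      push_cast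
      ring

/-- The parity of the number of occurrences of an element in the right inversion sequence of a word
depends only on the product of the word. -/
theorem count_rightInvSeq_congr [DecidableEq W] {ω ω' : List B}
    (h : cs.wordProd ω = cs.wordProd ω') (t : W) :
    ((cs.rightInvSeq ω).count t : ZMod 2) = (cs.rightInvSeq ω').count t := by
  have h1 := cs.lift_simpleParity_wordProd ω t 0
  rw [h, lift_simpleParity_wordProd] at h1
  have := (congrArg Prod.snd h1).symm
  simp only [zero_add] at this
  convert this

/-- The exchange property. -/
theorem exchange (ω : List B) {i : B} (h : cs.IsRightDescent (cs.wordProd ω) i) :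
    ∃ k < ω.length, cs.wordProd ω * cs.simple i = cs.wordProd (ω.eraseIdx k) := by
  classical
  obtain ⟨ω', hred, hω'⟩ := cs.exists_isReduced (cs.wordProd ω * cs.simple i)
  have hprod : cs.wordProd ω = cs.wordProd (ω'.concat i) := by
    rw [wordProd_concat, ← hω', simple_mul_simple_cancel_right]
  have hnot : cs.simple i ∉ cs.rightInvSeq ω' := by
    intro hmem
    have := (cs.isRightInversion_of_mem_rightInvSeq hred hmem).2
    rw [← hω', simple_mul_simple_cancel_right] at this
    exact lt_asymm this h
  have hcount := cs.count_rightInvSeq_congr hprod (cs.simple i)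
  have hone : (cs.rightInvSeq (ω'.concat i)).count (cs.simple i) = 1 := by
    rw [rightInvSeq_concat, List.concat_eq_append, List.count_append, List.count_eq_zero_of_not_mem]
    · simp
    · intro hmem
      obtain ⟨t, ht, hti⟩ := List.mem_map.1 hmem
      apply hnot
      have : t = cs.simple i := by
        have h2 : MulAut.conj (cs.simple i) t = MulAut.conj (cs.simple i) (cs.simple i) := by
          rw [hti]; simp
        exact (MulAut.conj (cs.simple i)).injective h2
      rwa [← this]
  rw [hone] at hcount
  have hmem : cs.simple i ∈ cs.rightInvSeq ω := by
    by_contra hc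
    rw [List.count_eq_zero_of_not_mem hc] at hcount
    simp at hcount
  obtain ⟨k, hk, hki⟩ := List.getElem_of_mem hmem
  have hk' : k < ω.length := by simpa using hk
  refine ⟨k, hk', ?_⟩
  rw [← wordProd_mul_getD_rightInvSeq, List.getD_eq_getElem _ _ hk, hki]

end Exchange

section Injective

open Real Module

variable (M) in
/-- The linear forms defining the geometric representation of a Coxeter matrix. -/
noncomputable def geometricForm (i : B) : Dual ℝ (B →₀ ℝ) :=
  Finsupp.linearCombination ℝ fun j => -2 * cos (π / M i j)

theorem geometricForm_single (i j : B) :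
    geometricForm M i (Finsupp.single j 1) = -2 * cos (π / M i j) := by
  simp [geometricForm]

theorem geometricForm_single_self (i : B) :
    geometricForm M i (Finsupp.single i 1) = 2 := by
  simp [geometricForm_single]

/-- The product of two reflections has order dividing `m` if the roots enclose the angle
`π - π / m`. -/
theorem reflection_mul_reflection_pow_eq_one {V : Type*} [AddCommGroup V] [Module ℝ V]
    {x y : V} {f g : Dual ℝ V} (hf : f x = 2) (hg : g y = 2) {m : ℕ} (hm : 2 ≤ m)
    (hfy : f y = -2 * cos (π / m)) (hgx : g x = -2 * cos (π / m)) :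
    (reflection hf * reflection hg) ^ m = 1 := by
  have hm0 : (m : ℝ) ≠ 0 := by positivity
  set θ : ℝ := 2 * π / m with hθ
  have ht : 2 * cos θ = f y * g x - 2 := by
    rw [hfy, hgx, hθ, mul_div_assoc, cos_two_mul]
    ring
  ext1 z
  rw [reflection_mul_reflection_pow_apply hf hg m z _ ht]
  rcases hm.eq_or_lt with rfl | hm2
  · have h1 : cos θ = -1 := by rw [hθ]; simp
    have hfy' : f y = 0 := by rw [hfy]; simp
    have hgx' : g x = 0 := by rw [hgx]; simp
    simp [h1, hfy', hgx']
    module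
  · have hsin : sin θ ≠ 0 := by
      refine (sin_pos_of_pos_of_lt_pi (by positivity) ?_).ne'
      rw [hθ, div_lt_iff₀ (by positivity)]
      have : (2 : ℝ) < m := by exact_mod_cast hm2
      nlinarith [pi_pos]
    have key : ∀ n : ℤ, (Polynomial.Chebyshev.S ℝ n).eval (2 * cos θ) =
        sin ((n + 1) * θ) / sin θ := fun n => by
      rw [← Polynomial.Chebyshev.S_two_mul_real_cos, mul_div_cancel_right₀ _ hsin]
    rcases Nat.even_or_odd' m with ⟨k, rfl | rfl⟩
    · have e1 : (((2 * k : ℕ) : ℤ) - 2) / 2 = k - 1 := by lia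
      have e2 : (((2 * k : ℕ) : ℤ) - 1) / 2 = k - 1 := by lia
      have hk : (Polynomial.Chebyshev.S ℝ ((k : ℤ) - 1)).eval (2 * cos θ) = 0 := by
        have : (((k - 1 : ℤ) : ℝ) + 1) * θ = π := by
          rw [hθ]
          push_cast at hm0 ⊢
          have := right_ne_zero_of_mul hm0
          field_simp
          ring
        rw [key, this, sin_pi, zero_div]
      rw [e1, e2, hk]
      simp
    · have e1 : (((2 * k + 1 : ℕ) : ℤ) - 2) / 2 = k - 1 := by lia
      have e2 : (((2 * k + 1 : ℕ) : ℤ) - 1) / 2 = k := by lia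
      have e3 : (((2 * k + 1 : ℕ) : ℤ) - 3) / 2 = k - 1 := by lia
      have e4 : (((2 * k + 1 : ℕ) : ℤ)) / 2 = k := by lia
      have hk : (Polynomial.Chebyshev.S ℝ (k : ℤ)).eval (2 * cos θ) +
          (Polynomial.Chebyshev.S ℝ ((k : ℤ) - 1)).eval (2 * cos θ) = 0 := by
        have : (((k : ℤ) : ℝ) + 1) * θ = 2 * π - (((k - 1 : ℤ) : ℝ) + 1) * θ := by
          rw [hθ]
          push_cast at hm0 ⊢
          field_simp
          ring
        rw [key, key, this, sin_two_pi_sub]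
        ring
      rw [e1, e2, e3, e4, hk]
      simp

/-- The reflections of the geometric representation satisfy the Coxeter relations. -/
theorem isLiftable_reflection :
    M.IsLiftable fun i => (reflection (geometricForm_single_self (M := M) i) :
      (B →₀ ℝ) ≃ₗ[ℝ] (B →₀ ℝ)) := by
  intro i j
  by_cases hij : i = j
  · subst hij
    rw [M.diagonal, pow_one]
    exact mul_eq_one_iff_inv_eq.2 (reflection_inv (geometricForm_single_self i))
  · by_cases h0 : M i j = 0
    · rw [h0, pow_zero]
    · have h1 := M.off_diagonal i j hij
      refine reflection_mul_reflection_pow_eq_one _ _ (by lia) (geometricForm_single i j) ?_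
      rw [geometricForm_single, M.symmetric]

end Injective

/-- The simple reflections of a Coxeter system are distinct. -/
theorem simple_injective : Function.Injective cs.simple := by
  intro i j hij
  by_contra hne
  have h := congrArg (cs.lift ⟨_, isLiftable_reflection⟩) hij
  rw [lift_apply_simple, lift_apply_simple] at h
  have h1 := congrArg (fun g => g (Finsupp.single i 1) i) h
  simp [Module.reflection_apply, geometricForm_single, Ne.symm hne] at h1
  norm_num at h1


section Parabolic

theorem simple_mem_parabolic {I : Set B} {i : B} (hi : i ∈ I) : cs.simple i ∈ cs.parabolic I :=
  Subgroup.subset_closure ⟨i, hi, rfl⟩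

theorem parabolic_mono {I J : Set B} (h : I ⊆ J) : cs.parabolic I ≤ cs.parabolic J :=
  Subgroup.closure_mono (Set.image_mono h)

theorem wordProd_mem_parabolic {I : Set B} {ω : List B} (h : ∀ i ∈ ω, i ∈ I) :
    cs.wordProd ω ∈ cs.parabolic I := by
  refine Subgroup.list_prod_mem _ fun x hx => ?_
  obtain ⟨i, hi, rfl⟩ := List.mem_map.1 hx
  exact cs.simple_mem_parabolic (h i hi)

theorem isReduced_eraseIdx {ω : List B} {i : B} (hω : cs.IsReduced ω)
    (hi : cs.IsRightDescent (cs.wordProd ω) i) {k : ℕ} (hk : k < ω.length)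
    (h : cs.wordProd ω * cs.simple i = cs.wordProd (ω.eraseIdx k)) :
    cs.IsReduced (ω.eraseIdx k) := by
  have h1 := cs.isRightDescent_iff.1 hi
  rw [h, hω.eq] at h1
  have h2 := List.length_eraseIdx_of_lt hk
  unfold IsReduced
  lia

/-- Every element of a standard parabolic subgroup is the product of a reduced word in the letters
of that subgroup. -/
theorem exists_isReduced_of_mem_parabolic {I : Set B} {x : W} (hx : x ∈ cs.parabolic I) :
    ∃ ω : List B, (∀ i ∈ ω, i ∈ I) ∧ cs.IsReduced ω ∧ x = cs.wordProd ω := by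
  have step : ∀ x, ∀ i ∈ I, (∃ ω : List B, (∀ i ∈ ω, i ∈ I) ∧ cs.IsReduced ω ∧ x = cs.wordProd ω) →
      ∃ ω : List B, (∀ i ∈ ω, i ∈ I) ∧ cs.IsReduced ω ∧ x * cs.simple i = cs.wordProd ω := by
    rintro _ i hi ⟨ω, hωI, hred, rfl⟩
    by_cases hdes : cs.IsRightDescent (cs.wordProd ω) i
    · obtain ⟨k, hk, heq⟩ := cs.exchange ω hdes
      exact ⟨ω.eraseIdx k, fun j hj => hωI j (List.mem_of_mem_eraseIdx hj),
        cs.isReduced_eraseIdx hred hdes hk heq, heq⟩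
    · refine ⟨ω.concat i, ?_, ?_, (cs.wordProd_concat i ω).symm⟩
      · intro j hj
        rcases (by simpa using hj : j ∈ ω ∨ j = i) with h | rfl
        · exact hωI j h
        · exact hi
      · have h1 := cs.not_isRightDescent_iff.1 hdes
        unfold IsReduced
        rw [wordProd_concat, h1, hred.eq, List.length_concat]
  induction hx using Subgroup.closure_induction_right with
  | one => exact ⟨[], by simp, by simp [IsReduced], by simp⟩
  | mul_right x hx y hy ih =>
    obtain ⟨i, hi, rfl⟩ := hy
    exact step x i hi ih
  | mul_inv_cancel x hx y hy ih =>
    obtain ⟨i, hi, rfl⟩ := hy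
    rw [inv_simple]
    exact step x i hi ih

/-- A simple reflection lies in a standard parabolic subgroup only if it is one of its
generators. -/
theorem mem_of_simple_mem_parabolic {I : Set B} {i : B} (h : cs.simple i ∈ cs.parabolic I) :
    i ∈ I := by
  obtain ⟨ω, hωI, hred, heq⟩ := cs.exists_isReduced_of_mem_parabolic h
  have h1 : ω.length = 1 := by rw [← hred.eq, ← heq, length_simple]
  obtain ⟨j, rfl⟩ := List.length_eq_one_iff.1 h1
  rw [wordProd_singleton] at heq
  rw [cs.simple_injective heq]
  exact hωI j (by simp)

/-- The exchange property for the product of an element of a standard parabolic subgroup and an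
arbitrary element. -/
theorem exchange_mul {I : Set B} {x : W} (hx : x ∈ cs.parabolic I) (y : W) {i : B}
    (h : cs.IsRightDescent (x * y) i) :
    (∃ x' ∈ cs.parabolic I, cs.length x' < cs.length x ∧ x * y * cs.simple i = x' * y) ∨
      cs.IsRightDescent y i := by
  obtain ⟨ω, hωI, hred, rfl⟩ := cs.exists_isReduced_of_mem_parabolic hx
  obtain ⟨υ, hυ, rfl⟩ := cs.exists_isReduced y
  rw [← wordProd_append] at h
  obtain ⟨k, hk, heq⟩ := cs.exchange _ h
  rw [wordProd_append] at heq
  by_cases hkω : k < ω.length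
  · rw [List.eraseIdx_append_of_lt_length hkω, wordProd_append] at heq
    refine Or.inl ⟨_, cs.wordProd_mem_parabolic fun j hj => hωI j (List.mem_of_mem_eraseIdx hj),
      ?_, heq⟩
    have h1 := cs.length_wordProd_le (ω.eraseIdx k)
    have h2 := List.length_eraseIdx_of_lt hkω
    rw [hred.eq]
    lia
  · rw [List.eraseIdx_append_of_length_le (not_lt.1 hkω), wordProd_append, mul_assoc,
      mul_right_inj] at heq
    rw [List.length_append] at hk
    refine Or.inr ?_
    have h1 := cs.length_wordProd_le (υ.eraseIdx (k - ω.length))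
    have h2 := List.length_eraseIdx_of_lt (l := υ) (i := k - ω.length) (by lia)
    unfold IsRightDescent
    rw [heq, hυ.eq]
    lia

/-- A right descent of an element of a standard parabolic subgroup is one of its generators. -/
theorem IsRightDescent.mem_of_mem_parabolic {cs : CoxeterSystem M W} {I : Set B} {x : W} {i : B}
    (h : cs.IsRightDescent x i) (hx : x ∈ cs.parabolic I) : i ∈ I := by
  rw [← mul_one x] at h
  rcases cs.exchange_mul hx 1 h with ⟨x', hx', -, heq⟩ | h
  · apply cs.mem_of_simple_mem_parabolic
    rw [mul_one, mul_one] at heq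
    rw [eq_inv_mul_of_mul_eq heq]
    exact mul_mem (inv_mem hx) hx'
  · exact absurd h (cs.not_isRightDescent_one i)

theorem length_mul_of_forall_le {J : Set B} {w : W}
    (hw : ∀ v ∈ cs.parabolic J, cs.length w ≤ cs.length (w * v)) {v : W}
    (hv : v ∈ cs.parabolic J) : cs.length (w * v) = cs.length w + cs.length v := by
  obtain ⟨ω, hωJ, hred, rfl⟩ := cs.exists_isReduced_of_mem_parabolic hv
  clear hv
  rw [hred.eq]
  induction ω using List.reverseRecOn with
  | nil => simp
  | append_singleton ω j ih =>
    have hω : ∀ i ∈ ω, i ∈ J := fun i hi => hωJ i (by simp [hi])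
    have hj : j ∈ J := hωJ j (by simp)
    have hredω : cs.IsReduced ω := by simpa using hred.take ω.length
    have ih := ih hω hredω
    have hmem := cs.wordProd_mem_parabolic hω
    rw [wordProd_append, wordProd_singleton, ← mul_assoc]
    by_cases hdes : cs.IsRightDescent (w * cs.wordProd ω) j
    · exfalso
      obtain ⟨υ, hυ, hwυ⟩ := cs.exists_isReduced w
      have hwω : cs.IsRightDescent (cs.wordProd ω) j ∨ ∃ w', cs.length w' < cs.length w ∧
          w * cs.wordProd ω * cs.simple j = w' * cs.wordProd ω := by
        have hwtop : w ∈ cs.parabolic Set.univ := by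
          rw [hwυ]; exact cs.wordProd_mem_parabolic fun _ _ => Set.mem_univ _
        rcases cs.exchange_mul hwtop _ hdes with ⟨w', -, h1, h2⟩ | h
        · exact Or.inr ⟨w', h1, h2⟩
        · exact Or.inl h
      rcases hwω with h | ⟨w', hlt, heq⟩
      · have h1 := hred.eq
        rw [wordProd_append, wordProd_singleton] at h1
        unfold IsRightDescent at h
        rw [h1, hredω.eq] at h
        simp at h
      · have h1 := hw (cs.wordProd ω * cs.simple j * (cs.wordProd ω)⁻¹)
          (mul_mem (mul_mem hmem (cs.simple_mem_parabolic hj)) (inv_mem hmem))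
        rw [← mul_assoc, ← mul_assoc, heq, mul_inv_cancel_right] at h1
        exact absurd hlt (not_lt.2 h1)
    · rw [cs.not_isRightDescent_iff.1 hdes, ih, List.length_append, List.length_singleton,
        add_assoc]

theorem exists_forall_le_mul (J : Set B) (w : W) :
    ∃ z ∈ cs.parabolic J, ∀ v ∈ cs.parabolic J, cs.length (w * z) ≤ cs.length (w * z * v) := by
  obtain ⟨z, hz, hmin⟩ := exists_minimalFor_of_wellFoundedLT (fun z => z ∈ cs.parabolic J)
    (fun z => cs.length (w * z)) ⟨1, one_mem _⟩
  refine ⟨z, hz, fun v hv => ?_⟩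
  rw [mul_assoc]
  by_contra hlt
  exact hlt (hmin (mul_mem hz hv) (not_le.1 hlt).le)

/-- If no generator of `W_J` is a right descent of `w`, then lengths add in the products of `w` with
the elements of `W_J`. -/
theorem length_mul_of_right_ascents {J : Set B} {w : W}
    (hw : ∀ j ∈ J, cs.length w < cs.length (w * cs.simple j)) {v : W}
    (hv : v ∈ cs.parabolic J) : cs.length (w * v) = cs.length w + cs.length v := by
  obtain ⟨z, hz, hmin⟩ := cs.exists_forall_le_mul J w
  have hadd : ∀ v ∈ cs.parabolic J, cs.length (w * z * v) = cs.length (w * z) + cs.length v :=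
    fun v hv => cs.length_mul_of_forall_le hmin hv
  suffices hz1 : z = 1 by
    subst hz1
    simpa using hadd v hv
  by_contra hne
  obtain ⟨j, hj⟩ := cs.exists_rightDescent_of_ne_one (inv_ne_one.2 hne)
  have hjJ : j ∈ J := hj.mem_of_mem_parabolic (inv_mem hz)
  have h1 := hadd _ (inv_mem hz)
  have h2 := hadd _ (mul_mem (inv_mem hz) (cs.simple_mem_parabolic hjJ))
  rw [← mul_assoc, mul_inv_cancel_right] at h2
  rw [mul_inv_cancel_right] at h1
  have h3 := hw j hjJ
  unfold IsRightDescent at hj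
  lia

theorem length_mul_of_left_ascents {I : Set B} {w : W}
    (hw : ∀ i ∈ I, cs.length w < cs.length (cs.simple i * w)) {u : W}
    (hu : u ∈ cs.parabolic I) : cs.length (u * w) = cs.length u + cs.length w := by
  rw [← length_inv, mul_inv_rev, cs.length_mul_of_right_ascents _ (inv_mem hu), length_inv,
    length_inv, add_comm]
  intro i hi
  rw [← cs.inv_simple, ← mul_inv_rev, length_inv, length_inv]
  exact hw i hi

/-- An element without left descents in `I` and right descents in `J` has minimal length in its
double coset. -/
theorem length_le_of_mem_doubleCoset {I J : Set B} {w : W}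
    (hI : ∀ i ∈ I, cs.length w < cs.length (cs.simple i * w))
    (hJ : ∀ j ∈ J, cs.length w < cs.length (w * cs.simple j)) {x : W}
    (hx : x ∈ cs.doubleCoset I w J) : cs.length w ≤ cs.length x := by
  obtain ⟨y, ⟨u, hu, v, hv, hy⟩, hmin⟩ := exists_minimalFor_of_wellFoundedLT
    (fun y => y ∈ cs.doubleCoset I w J) cs.length ⟨x, hx⟩
  have hle : ∀ z ∈ cs.doubleCoset I w J, cs.length y ≤ cs.length z :=
    fun z hz => (le_total _ _).elim id fun h => hmin hz h
  refine le_trans ?_ (hle x hx)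
  have h1 : cs.length (y * v⁻¹) = cs.length y + cs.length v⁻¹ := by
    refine cs.length_mul_of_right_ascents (fun j hj => lt_of_le_of_ne (hle _ ?_)
      (cs.length_mul_simple_ne y j).symm) (inv_mem hv)
    exact ⟨u, hu, v * cs.simple j, mul_mem hv (cs.simple_mem_parabolic hj), by
      rw [hy, mul_assoc _ v]⟩
  have h2 : cs.length (u⁻¹ * y) = cs.length u⁻¹ + cs.length y := by
    refine cs.length_mul_of_left_ascents (fun i hi => lt_of_le_of_ne (hle _ ?_)
      (cs.length_simple_mul_ne y i).symm) (inv_mem hu)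
    exact ⟨cs.simple i * u, mul_mem (cs.simple_mem_parabolic hi) hu, v, hv, by
      rw [hy]; simp only [mul_assoc]⟩
  have h3 := cs.length_mul_of_left_ascents hI hu
  have h4 := cs.length_mul_of_right_ascents hJ hv
  rw [hy, mul_inv_cancel_right, ← hy, length_inv] at h1
  rw [hy, mul_assoc, inv_mul_cancel_left, ← mul_assoc, ← hy, length_inv] at h2
  lia

end Parabolic
section DoubleCoset

variable {cs} in
/-- If the generators of `W_K` map a set into itself by left multiplication, so does `W_K`. -/
theorem mul_mem_of_forall_simple_mul_mem {K : Set B} {C : Set W}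
    (h : ∀ k ∈ K, ∀ c ∈ C, cs.simple k * c ∈ C) {x : W} (hx : x ∈ cs.parabolic K) {c : W}
    (hc : c ∈ C) : x * c ∈ C := by
  obtain ⟨ω, hω, -, rfl⟩ := cs.exists_isReduced_of_mem_parabolic hx
  clear hx
  induction ω with
  | nil => simpa using hc
  | cons k ω ih =>
    rw [wordProd_cons, mul_assoc]
    exact h k (hω k (by simp)) _ (ih fun i hi => hω i (by simp [hi]))

theorem self_mem_doubleCoset (I : Set B) (w : W) (J : Set B) : w ∈ cs.doubleCoset I w J :=
  ⟨1, one_mem _, 1, one_mem _, by simp⟩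

theorem mul_mem_doubleCoset {I : Set B} {w : W} {J : Set B} {u x : W}
    (hu : u ∈ cs.parabolic I) (hx : x ∈ cs.doubleCoset I w J) : u * x ∈ cs.doubleCoset I w J := by
  obtain ⟨a, ha, b, hb, rfl⟩ := hx
  exact ⟨u * a, mul_mem hu ha, b, hb, by simp only [mul_assoc]⟩

theorem doubleCoset_inv (I : Set B) (w : W) (J : Set B) :
    {x | x⁻¹ ∈ cs.doubleCoset I w J} = cs.doubleCoset J w⁻¹ I := by
  ext x
  constructor
  · rintro ⟨u, hu, v, hv, h⟩
    exact ⟨v⁻¹, inv_mem hv, u⁻¹, inv_mem hu, by rw [← inv_inv x, h]; simp [mul_assoc]⟩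
  · rintro ⟨u, hu, v, hv, h⟩
    exact ⟨v⁻¹, inv_mem hv, u⁻¹, inv_mem hu, by rw [h]; simp [mul_assoc]⟩

theorem IsMinimalPresentation.inv {cs : CoxeterSystem M W} {I : Set B} {w : W} {J : Set B}
    (h : cs.IsMinimalPresentation I w J) : cs.IsMinimalPresentation J w⁻¹ I := by
  obtain ⟨h1, h2, h3, h4⟩ := h
  refine ⟨fun s hs => ?_, fun s hs => ?_, by simpa only [inv_inv] using h4,
    by simpa only [inv_inv] using h3⟩
  · rw [← cs.inv_simple, ← mul_inv_rev, length_inv, length_inv]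
    exact h2 s hs
  · rw [← cs.inv_simple, ← mul_inv_rev, length_inv, length_inv]
    exact h1 s hs

/-- The simple reflections that permute a double coset `C = W_I w W_J` from the left are those that
occur on the left of some presentation of `C`. -/
theorem exists_doubleCoset_eq_iff {I : Set B} {w : W} {J : Set B} {s : B} :
    (∃ (I' J' : Set B) (w' : W), cs.doubleCoset I w J = cs.doubleCoset I' w' J' ∧ s ∈ I') ↔
      ∀ c ∈ cs.doubleCoset I w J, cs.simple s * c ∈ cs.doubleCoset I w J := by
  constructor
  · rintro ⟨I', J', w', h, hs⟩ c hc
    rw [h] at hc ⊢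
    exact cs.mul_mem_doubleCoset (cs.simple_mem_parabolic hs) hc
  · intro h
    refine ⟨insert s I, J, w, ?_, Set.mem_insert s I⟩
    ext x
    constructor
    · rintro ⟨u, hu, v, hv, rfl⟩
      exact ⟨u, cs.parabolic_mono (Set.subset_insert s I) hu, v, hv, rfl⟩
    · rintro ⟨u, hu, v, hv, rfl⟩
      rw [mul_assoc]
      refine mul_mem_of_forall_simple_mul_mem ?_ hu ⟨1, one_mem _, v, hv, by simp⟩
      rintro k (rfl | hk) c hc
      · exact h c hc
      · exact cs.mul_mem_doubleCoset (cs.simple_mem_parabolic hk) hc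

/-- If `w` has no left descents in `K` and no right descents in `J`, then a right descent in `J` of
`x * w`, where `x ∈ W_K`, is conjugate under `w` to a right descent of `x`. -/
theorem exists_isRightDescent_of_mul {K J : Set B} {w : W}
    (hK : ∀ k ∈ K, cs.length w < cs.length (cs.simple k * w))
    (hJ : ∀ j ∈ J, cs.length w < cs.length (w * cs.simple j)) {x : W}
    (hx : x ∈ cs.parabolic K) {j : B} (hj : j ∈ J) (hdes : cs.IsRightDescent (x * w) j) :
    ∃ k, cs.simple k = w * cs.simple j * w⁻¹ ∧ cs.IsRightDescent x k := by
  rcases cs.exchange_mul hx w hdes with ⟨x', hx', hlt, heq⟩ | h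
  · have hmem : x⁻¹ * x' ∈ cs.parabolic K := mul_mem (inv_mem hx) hx'
    have hconj : x⁻¹ * x' * w = w * cs.simple j := by
      rw [mul_assoc, ← heq]
      simp [mul_assoc]
    have h1 := cs.length_mul_of_left_ascents hK hmem
    have h2 := cs.length_mul_of_right_ascents hJ (cs.simple_mem_parabolic hj)
    rw [hconj, h2, length_simple] at h1
    obtain ⟨k, hk⟩ := cs.length_eq_one_iff.1 (show cs.length (x⁻¹ * x') = 1 by lia)
    refine ⟨k, by rw [← hk, ← hconj, mul_inv_cancel_right], ?_⟩
    unfold IsRightDescent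
    rwa [← hk, mul_inv_cancel_left]
  · exact absurd h (not_lt.2 (hJ j hj).le)

/-- If `w` has no left descents in `K` and no right descents in `J`, and `x ∈ W_K` has no right
descents in `w J w⁻¹`, then `x * w ∈ W_I w W_J` only if `x ∈ W_I`. -/
theorem mem_parabolic_of_not_isRightDescent {I K J : Set B} {w : W}
    (hK : ∀ k ∈ K, cs.length w < cs.length (cs.simple k * w))
    (hJ : ∀ j ∈ J, cs.length w < cs.length (w * cs.simple j)) {x : W}
    (hx : x ∈ cs.parabolic K) (hxC : x * w ∈ cs.doubleCoset I w J)
    (hdes : ∀ k, (∃ j ∈ J, cs.simple k = w * cs.simple j * w⁻¹) → ¬ cs.IsRightDescent x k) :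
    x ∈ cs.parabolic I := by
  have hxw : ∀ j ∈ J, cs.length (x * w) < cs.length (x * w * cs.simple j) := by
    intro j hj
    refine lt_of_le_of_ne (not_lt.1 fun h => ?_) (cs.length_mul_simple_ne _ j).symm
    obtain ⟨k, hk, hxk⟩ := cs.exists_isRightDescent_of_mul hK hJ hx hj h
    exact hdes k ⟨j, hj, hk⟩ hxk
  obtain ⟨a, ha, b, hb, hab⟩ := hxC
  obtain ⟨u, ⟨hu, v, hv, huv⟩, hmin⟩ := exists_minimalFor_of_wellFoundedLT
    (fun u => u ∈ cs.parabolic I ∧ ∃ v ∈ cs.parabolic J, x * w = u * w * v) cs.length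
    ⟨a, ha, b, hb, hab⟩
  have huw : ∀ j ∈ J, cs.length (u * w) < cs.length (u * w * cs.simple j) := by
    intro j hj
    refine lt_of_le_of_ne (not_lt.1 fun h => ?_) (cs.length_mul_simple_ne _ j).symm
    rcases cs.exchange_mul hu w h with ⟨u', hu', hlt, heq⟩ | h
    · refine absurd (hmin ⟨hu', cs.simple j * v, mul_mem (cs.simple_mem_parabolic hj) hv, ?_⟩
        hlt.le) (not_le.2 hlt)
      rw [← heq, huv, ← mul_assoc, simple_mul_simple_cancel_right]
    · exact absurd h (not_lt.2 (hJ j hj).le)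
  have h1 := cs.length_mul_of_right_ascents huw hv
  have h2 := cs.length_mul_of_right_ascents hxw (inv_mem hv)
  rw [huv, mul_inv_cancel_right, length_inv] at h2
  have hv1 : v = 1 := cs.length_eq_zero_iff.1 (by lia)
  rw [hv1, mul_one] at huv
  rw [mul_right_cancel huv]
  exact hu

/-- If `b` is adjacent to the only right descent `a` of `y ∈ W_P` and does not lie in `P`, then `b`
is the only right descent of `y * b`. -/
theorem eq_of_isRightDescent_mul_simple {P : Set B} {y : W} {a b : B} (hy : y ∈ cs.parabolic P)
    (hya : ∀ k, cs.IsRightDescent y k → k = a) (hab : cs.adjacent a b) (hb : b ∉ P) {k : B}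
    (hk : cs.IsRightDescent (y * cs.simple b) k) : k = b := by
  by_contra hkb
  have hkP : k ∈ P := by
    have hmem : y * cs.simple b ∈ cs.parabolic (insert b P) :=
      mul_mem (cs.parabolic_mono (Set.subset_insert b P) hy)
        (cs.simple_mem_parabolic (Set.mem_insert b P))
    exact (hk.mem_of_mem_parabolic hmem).resolve_left hkb
  have hbP : ∀ i ∈ P, cs.length (cs.simple b) < cs.length (cs.simple i * cs.simple b) := by
    intro i hi
    refine lt_of_le_of_ne (not_lt.1 fun h => hb ?_) (cs.length_simple_mul_ne _ i).symm
    rw [length_simple, Nat.lt_one_iff, length_eq_zero_iff, mul_eq_one_iff_eq_inv, inv_simple] at h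
    rwa [← cs.simple_injective h]
  have hadd : ∀ z ∈ cs.parabolic P, cs.length (z * cs.simple b) = cs.length z + 1 := by
    intro z hz
    rw [cs.length_mul_of_left_ascents hbP hz, length_simple]
  have hnot : ¬ cs.IsRightDescent (cs.simple b) k := by
    intro h
    refine hkb ?_
    have h1 := h.mem_of_mem_parabolic (cs.simple_mem_parabolic (Set.mem_singleton b))
    simpa using h1
  obtain ⟨y', hy', -, heq⟩ := (cs.exchange_mul hy _ hk).resolve_right hnot
  have hcomm : cs.simple b * cs.simple k = cs.simple k * cs.simple b := by
    have hconj : y⁻¹ * y' * cs.simple b = cs.simple b * cs.simple k := by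
      rw [mul_assoc, ← heq]
      simp [mul_assoc]
    have h1 := hadd _ (mul_mem (inv_mem hy) hy')
    have hdes : cs.IsRightDescent (cs.simple b * cs.simple k) b := by
      unfold IsRightDescent
      rw [← hconj, h1, simple_mul_simple_cancel_right]
      lia
    rcases cs.exchange_mul (cs.simple_mem_parabolic (Set.mem_singleton b)) _ hdes with
      ⟨z, -, hz, heq⟩ | h
    · rw [length_simple, Nat.lt_one_iff, length_eq_zero_iff] at hz
      rw [hz, one_mul] at heq
      conv_rhs => rw [← heq, simple_mul_simple_cancel_right]
    · exact absurd (h.mem_of_mem_parabolic (cs.simple_mem_parabolic (Set.mem_singleton k)))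
        (Ne.symm hkb)
  have hyk : cs.IsRightDescent y k := by
    unfold IsRightDescent at hk ⊢
    rw [mul_assoc, hcomm, ← mul_assoc, hadd y hy,
      hadd _ (mul_mem hy (cs.simple_mem_parabolic hkP))] at hk
    lia
  rw [hya k hyk] at hcomm
  exact hab.2 hcomm.symm

/-- If a left ascent `s ∉ I` of `w` in `w J w⁻¹` permutes `W_I w W_J` from the left and is adjacent
to `i ∈ I`, then the component of `i` in `I` is contained in `w J w⁻¹`. -/
theorem exists_conj_of_mem_component {I J : Set B} {w : W}
    (hI : ∀ i ∈ I, cs.length w < cs.length (cs.simple i * w))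
    (hJ : ∀ j ∈ J, cs.length w < cs.length (w * cs.simple j)) {s : B}
    (hs : ∀ c ∈ cs.doubleCoset I w J, cs.simple s * c ∈ cs.doubleCoset I w J) (hsI : s ∉ I)
    (hsw : cs.length w < cs.length (cs.simple s * w))
    (hsJ : ∃ j ∈ J, cs.simple s = w * cs.simple j * w⁻¹) {i : B} (hi : i ∈ I)
    (hsi : cs.adjacent s i) {k : B} (hk : k ∈ cs.component I i) :
    ∃ j ∈ J, cs.simple k = w * cs.simple j * w⁻¹ := by
  let P (k : B) : Prop := ∃ Q : Set B, k ∈ Q ∧ Q ⊆ insert s I ∧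
    Q ⊆ {k | ∃ j ∈ J, cs.simple k = w * cs.simple j * w⁻¹} ∧
    ∀ q ∈ Q, ∃ y ∈ cs.parabolic Q, y ∉ cs.parabolic I ∧ ∀ l, cs.IsRightDescent y l → l = q
  have hstep : ∀ a b, P a → b ∈ I → cs.adjacent a b → P b := by
    rintro a b ⟨Q, haQ, hQ, hQJ, hq⟩ hb hab
    by_cases hbQ : b ∈ Q
    · exact ⟨Q, hbQ, hQ, hQJ, hq⟩
    obtain ⟨y, hy, hyI, hya⟩ := hq a haQ
    have hyb : y * cs.simple b ∉ cs.parabolic I := fun h => hyI <| by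
      simpa using mul_mem h (cs.simple_mem_parabolic hb)
    have hdes := fun l => cs.eq_of_isRightDescent_mul_simple hy hya hab hbQ (k := l)
    have hmono := cs.parabolic_mono (Set.subset_insert b Q)
    refine ⟨insert b Q, Set.mem_insert b Q, ?_, ?_, ?_⟩
    · exact Set.insert_subset (Set.mem_insert_of_mem s hb) hQ
    · refine Set.insert_subset ?_ hQJ
      by_contra hbJ
      have hK : ∀ k ∈ insert s I, cs.length w < cs.length (cs.simple k * w) := by
        rintro k (rfl | hk)
        · exact hsw
        · exact hI k hk
      have hmem : y * cs.simple b ∈ cs.parabolic (insert s I) :=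
        mul_mem (cs.parabolic_mono hQ hy) (cs.simple_mem_parabolic (Set.mem_insert_of_mem s hb))
      refine hyb (cs.mem_parabolic_of_not_isRightDescent hK hJ hmem ?_ ?_)
      · refine mul_mem_of_forall_simple_mul_mem ?_ hmem (cs.self_mem_doubleCoset I w J)
        rintro k (rfl | hk) c hc
        · exact hs c hc
        · exact cs.mul_mem_doubleCoset (cs.simple_mem_parabolic hk) hc
      · intro l hl hyl
        rw [hdes l hyl] at hl
        exact hbJ hl
    · rintro q (rfl | hqQ)
      · exact ⟨_, mul_mem (hmono hy) (cs.simple_mem_parabolic (Set.mem_insert q Q)), hyb, hdes⟩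
      · obtain ⟨z, hz, hzI, hzq⟩ := hq q hqQ
        exact ⟨z, hmono hz, hzI, hzq⟩
  have hPs : P s := by
    refine ⟨{s}, rfl, by simp, by simpa using hsJ, ?_⟩
    rintro q rfl
    have hmem := cs.simple_mem_parabolic (Set.mem_singleton q)
    exact ⟨_, hmem, fun h => hsI (cs.mem_of_simple_mem_parabolic h),
      fun l hl => hl.mem_of_mem_parabolic hmem⟩
  have hPk : P k := by
    induction hk with
    | refl => exact hstep s i hPs hi hsi
    | tail _ hbc ih => exact hstep _ _ ih hbc.2.1 hbc.2.2
  obtain ⟨Q, hkQ, -, hQJ, -⟩ := hPk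
  exact hQJ hkQ

/-- The simple reflections occurring on the left of some presentation of a double coset, in terms of
a minimal presentation. -/
theorem left_descents_of_isMinimalPresentation {I J : Set B} {w : W} {C : Set W}
    (hC : C = cs.doubleCoset I w J) (hmin : cs.IsMinimalPresentation I w J) :
    {s : B | ∃ (I' J' : Set B) (w' : W), C = cs.doubleCoset I' w' J' ∧ s ∈ I'} =
      I ∪ {s : B | (∃ t ∈ J, cs.simple s = w * cs.simple t * w⁻¹) ∧
        ∀ i ∈ I, ¬ cs.adjacent s i} := by
  subst hC
  obtain ⟨hI, hJ, hcomp, -⟩ := hmin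
  ext s
  rw [Set.mem_ofPred_eq, exists_doubleCoset_eq_iff]
  constructor
  · intro hs
    refine or_iff_not_imp_left.2 fun hsI => ?_
    have hswC := hs w (cs.self_mem_doubleCoset I w J)
    have hsw : cs.length w < cs.length (cs.simple s * w) :=
      lt_of_le_of_ne (cs.length_le_of_mem_doubleCoset hI hJ hswC)
        (cs.length_simple_mul_ne w s).symm
    have hK : ∀ k ∈ insert s I, cs.length w < cs.length (cs.simple k * w) := by
      rintro k (rfl | hk)
      · exact hsw
      · exact hI k hk
    have hsJ : ∃ t ∈ J, cs.simple s = w * cs.simple t * w⁻¹ := by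
      by_contra hsJ
      refine hsI (cs.mem_of_simple_mem_parabolic
        (cs.mem_parabolic_of_not_isRightDescent hK hJ
          (cs.simple_mem_parabolic (Set.mem_insert s I)) hswC fun k hk hdes => hsJ ?_))
      have hks : k = s := hdes.mem_of_mem_parabolic
        (cs.simple_mem_parabolic (Set.mem_singleton s))
      rwa [← hks]
    exact ⟨hsJ, fun i hi hsi => hcomp i hi fun k hk =>
      cs.exists_conj_of_mem_component hI hJ hs hsI hsw hsJ hi hsi hk⟩
  · rintro (hs | ⟨⟨t, ht, hst⟩, hadj⟩) c hc
    · exact cs.mul_mem_doubleCoset (cs.simple_mem_parabolic hs) hc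
    · obtain ⟨u, hu, v, hv, rfl⟩ := hc
      have hcomm : Commute (cs.simple s) u := by
        have hle : cs.parabolic I ≤ Subgroup.centralizer {cs.simple s} := by
          refine (Subgroup.closure_le _).2 ?_
          rintro _ ⟨i, hi, rfl⟩
          rw [SetLike.mem_coe, Subgroup.mem_centralizer_singleton_iff]
          by_contra hne
          refine hadj i hi ⟨?_, fun h => hne h.symm⟩
          rintro rfl
          exact hne rfl
        exact (Subgroup.mem_centralizer_singleton_iff.1 (hle hu)).symm
      refine ⟨u, hu, cs.simple t * v, mul_mem (cs.simple_mem_parabolic ht) hv, ?_⟩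
      rw [← mul_assoc, ← mul_assoc, hcomm.eq, mul_assoc u, hst]
      simp [mul_assoc]

end DoubleCoset

end CoxeterSystem

/-- If `C = W_I w W_J` is a minimal presentation, then `M_L(C)` is the union of `I` with
the simple reflections of `(w J w⁻¹) ∩ S` not adjacent to `I`, and symmetrically for
`M_R(C)`. -/
theorem descent_sets_of_minimal_presentation
    [Fintype B] {M : CoxeterMatrix B} (cs : CoxeterSystem M W)
    (I J : Set B) (w : W) (C : Set W)
    (hC : C = cs.doubleCoset I w J)
    (hmin : cs.IsMinimalPresentation I w J) :
    {s : B | ∃ (I' J' : Set B) (w' : W), C = cs.doubleCoset I' w' J' ∧ s ∈ I'} =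
      I ∪ {s : B | (∃ t ∈ J, cs.simple s = w * cs.simple t * w⁻¹) ∧
        ∀ i ∈ I, ¬ cs.adjacent s i} ∧
    {s : B | ∃ (I' J' : Set B) (w' : W), C = cs.doubleCoset I' w' J' ∧ s ∈ J'} =
      J ∪ {s : B | (∃ t ∈ I, cs.simple s = w⁻¹ * cs.simple t * w) ∧
        ∀ j ∈ J, ¬ cs.adjacent s j} := by
  refine ⟨cs.left_descents_of_isMinimalPresentation hC hmin, ?_⟩
  have h := cs.left_descents_of_isMinimalPresentation rfl hmin.inv
  rw [inv_inv] at h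
  rw [← h]
  ext s
  constructor
  · rintro ⟨I', J', w', hC', hs⟩
    exact ⟨J', I', w'⁻¹, by rw [← doubleCoset_inv, ← doubleCoset_inv, ← hC, hC'], hs⟩
  · rintro ⟨I', J', w', hC', hs⟩
    refine ⟨J', I', w'⁻¹, ?_, hs⟩
    rw [← doubleCoset_inv, ← hC', doubleCoset_inv, inv_inv, hC]
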